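/- Let τ ∈ ℂ with Im τ > 0, let q = e^{2πiτ}, and define h(τ) = q⁻¹·∏_{n=1}^{∞} (1−q^{7n−3})(1−q^{7n−4})(1−q^{7n−2})²(1−q^{7n−5})² / ((1−q^{7n−1})³(1−q^{7n−6})³). Then h(τ) ≠ 0, h(τ) ≠ 1, and the transformation formulas h((2τ−1)/(7τ−3)) = (h(τ)−1)/h(τ) and h((3τ−1)/(7τ−2)) = 1/(1−h(τ)) hold (note Im((2τ−1)/(7τ−3)) > 0 and Im((3τ−1)/(7τ−2)) > 0, so both sides are defined). -/

import Mathlib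

open Complex

/-- Duke's Hauptmodul `h(τ)` for `Γ₁(7)`, defined for `τ` in the upper
half-plane via the absolutely convergent product in `q = e^{2πiτ}`:
`h(τ) = q⁻¹·∏_{n≥1} (1-q^{7n-3})(1-q^{7n-4})(1-q^{7n-2})²(1-q^{7n-5})² /
((1-q^{7n-1})³(1-q^{7n-6})³)`. -/
noncomputable def hTau (τ : ℂ) : ℂ :=
  let q : ℂ := Complex.exp (2 * Real.pi * Complex.I * τ)
  q⁻¹ * ∏' n : ℕ,
    ((1 - q ^ (7 * n + 4)) * (1 - q ^ (7 * n + 3)) * (1 - q ^ (7 * n + 5)) ^ 2 *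
        (1 - q ^ (7 * n + 2)) ^ 2) /
      ((1 - q ^ (7 * n + 6)) ^ 3 * (1 - q ^ (7 * n + 1)) ^ 3)

open Filter Topology

/-- Finite q-Pochhammer symbol. -/
noncomputable def poch (Q : ℂ) (n : ℕ) : ℂ := ∏ k ∈ Finset.range n, (1 - Q ^ (k + 1))

/-- Inverse q-Pochhammer symbol extended by zero. -/
noncomputable def ipoch (Q : ℂ) (n : ℤ) : ℂ := if n < 0 then 0 else (poch Q n.toNat)⁻¹

lemma one_sub_pow_ne_zero' {Q : ℂ} (hQ : ‖Q‖ < 1) (k : ℕ) (hk : k ≠ 0) : 1 - Q ^ k ≠ 0 := by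
  intro h
  have : ‖Q ^ k‖ = 1 := by rw [← sub_eq_zero.mp h]; simp
  rw [norm_pow] at this
  exact absurd this (pow_lt_one₀ (norm_nonneg _) hQ hk).ne

lemma poch_ne_zero {Q : ℂ} (hQ : ‖Q‖ < 1) (n : ℕ) : poch Q n ≠ 0 :=
  Finset.prod_ne_zero_iff.mpr fun k _ => one_sub_pow_ne_zero' hQ (k + 1) (by simp)

lemma ipoch_sub_one {Q : ℂ} (hQ : ‖Q‖ < 1) (n : ℤ) :
    ipoch Q (n - 1) = (1 - Q ^ n) * ipoch Q n := by
  rcases lt_trichotomy n 0 with h | rfl | h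
  · simp [ipoch, h, show n - 1 < 0 by omega]
  · simp [ipoch]
  · obtain ⟨m, rfl⟩ : ∃ m : ℕ, n = m + 1 := ⟨(n - 1).toNat, by omega⟩
    have h1 : ¬ ((m : ℤ) + 1 < 0) := by omega
    have h2 : ((m : ℤ) + 1).toNat = m + 1 := by omega
    have h3 := one_sub_pow_ne_zero' hQ (m + 1) (by simp)
    have h4 := poch_ne_zero hQ m
    simp only [ipoch, h1, h2, add_sub_cancel_right, Int.toNat_natCast, if_false,
      show ¬ ((m : ℤ) < 0) by omega]
    rw [show poch Q (m + 1) = poch Q m * (1 - Q ^ (m + 1)) from Finset.prod_range_succ _ _]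
    rw [show Q ^ ((m : ℤ) + 1) = Q ^ (m + 1) by exact_mod_cast zpow_natCast Q (m + 1)]
    field_simp

/-- Gaussian binomial coefficient `[2N choose N+n]`. -/
noncomputable def gbin (Q : ℂ) (N : ℕ) (n : ℤ) : ℂ :=
  poch Q (2 * N) * ipoch Q (N + n) * ipoch Q (N - n)

lemma gbin_succ {Q : ℂ} (hQ : ‖Q‖ < 1) (h0 : Q ≠ 0) (N : ℕ) (n : ℤ) :
    gbin Q (N + 1) n = (1 + Q ^ (2 * N + 1)) * gbin Q N n +
      Q ^ N * Q ^ (n + 1) * gbin Q N (n + 1) + Q ^ (N + 1) * Q ^ (-n) * gbin Q N (n - 1) := by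
  have a1 := ipoch_sub_one hQ (N + 1 + n)
  have b1 := ipoch_sub_one hQ (N + 1 - n)
  have a2 := ipoch_sub_one hQ (N + n)
  have b2 := ipoch_sub_one hQ (N - n)
  have hp : poch Q (2 * (N + 1)) = poch Q (2 * N) * (1 - Q ^ (2 * N + 1)) * (1 - Q ^ (2 * N + 2)) := by
    rw [show 2 * (N + 1) = 2 * N + 1 + 1 by ring, poch, Finset.prod_range_succ,
      Finset.prod_range_succ, poch]
  rw [show (N : ℤ) + 1 + n - 1 = N + n by ring] at a1
  rw [show (N : ℤ) + 1 - n - 1 = N - n by ring] at b1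
  simp only [gbin, hp]
  push_cast
  rw [show (N : ℤ) + (n + 1) = N + 1 + n by ring, show (N : ℤ) - (n + 1) = N - n - 1 by ring,
    show (N : ℤ) + (n - 1) = N + n - 1 by ring, show (N : ℤ) - (n - 1) = N + 1 - n by ring,
    a2, b2, a1, b1]
  generalize ipoch Q (N + 1 + n) = U
  generalize ipoch Q (N + 1 - n) = V
  simp only [zpow_add₀ h0, zpow_sub₀ h0, zpow_neg, zpow_natCast, zpow_one]
  have hx : Q ^ n ≠ 0 := zpow_ne_zero _ h0
  generalize Q ^ n = X at *
  rw [show Q ^ (2 * N + 1) = Q ^ N * Q ^ N * Q by ring,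
    show Q ^ (2 * N + 2) = Q ^ N * Q ^ N * Q * Q by ring, show Q ^ (N + 1) = Q ^ N * Q by ring]
  generalize Q ^ N = Y
  field_simp
  ring

/-- Finite Jacobi triple product. -/
lemma finite_triple {Q w : ℂ} (hQ : ‖Q‖ < 1) (h0 : Q ≠ 0) (hw : w ≠ 0) (t : ℤ → ℂ) (t0 : t 0 = 1)
    (ht : ∀ n, t (n + 1) = - w * Q ^ (n + 1) * t n) (N : ℕ) :
    HasSum (fun n : ℤ => gbin Q N n * t n)
      (∏ k ∈ Finset.range N, ((1 - w⁻¹ * Q ^ k) * (1 - w * Q ^ (k + 1)))) := by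
  induction N with
  | zero =>
    have : (fun n : ℤ => gbin Q 0 n * t n) = fun n => if n = 0 then 1 else 0 := by
      ext n
      rcases lt_trichotomy n 0 with h | rfl | h
      · simp [gbin, ipoch, h, h.ne]
      · simp [gbin, ipoch, poch, t0]
      · simp [gbin, ipoch, h, h.ne']
    rw [this]
    simpa using hasSum_ite_eq (0 : ℤ) (1 : ℂ)
  | succ N ih =>
    rw [Finset.prod_range_succ]
    have i1 := ih.mul_left (1 + Q ^ (2 * N + 1))
    have i2 := (((Equiv.addRight (1 : ℤ)).hasSum_iff).2 ih).mul_left (- w⁻¹ * Q ^ N)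
    have i3 := (((Equiv.addRight (-1 : ℤ)).hasSum_iff).2 ih).mul_left (- w * Q ^ (N + 1))
    convert! (i1.add i2).add i3 using 1
    · ext n
      have e1 := ht n
      have e2 := ht (n - 1)
      have hn : Q ^ n ≠ 0 := zpow_ne_zero _ h0
      rw [sub_add_cancel] at e2
      have e3 : t (n - 1) = - w⁻¹ * Q ^ (-n) * t n := by
        rw [e2, zpow_neg]; field_simp
      simp only [Function.comp, Equiv.coe_addRight, ← sub_eq_add_neg]
      rw [gbin_succ hQ h0, e1, e3]
      field_simp
    · field_simp
      ring

lemma summable_norm_geom {Q : ℂ} (hQ : ‖Q‖ < 1) (c : ℂ) : Summable fun n : ℕ => ‖- (c * Q ^ n)‖ := by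
  simp only [norm_neg, norm_mul, norm_pow]
  exact (summable_geometric_of_lt_one (norm_nonneg _) hQ).mul_left _

lemma multipliable_geom {Q : ℂ} (hQ : ‖Q‖ < 1) (c : ℂ) :
    Multipliable fun n : ℕ => 1 - c * Q ^ n := by
  simp only [sub_eq_add_neg]
  exact multipliable_one_add_of_summable (summable_norm_geom hQ c)

lemma tprod_geom_ne_zero {Q : ℂ} (hQ : ‖Q‖ < 1) (c : ℂ) (h : ∀ n : ℕ, 1 - c * Q ^ n ≠ 0) :
    ∏' n : ℕ, (1 - c * Q ^ n) ≠ 0 := by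
  simp only [sub_eq_add_neg] at h ⊢
  exact tprod_one_add_ne_zero_of_summable h (summable_norm_geom hQ c)

lemma poch_tendsto {Q : ℂ} (hQ : ‖Q‖ < 1) : ∃ E : ℂ, E ≠ 0 ∧ Tendsto (poch Q) atTop (𝓝 E) := by
  refine ⟨∏' n : ℕ, (1 - Q * Q ^ n), tprod_geom_ne_zero hQ Q fun n => ?_, ?_⟩
  · rw [← pow_succ']; exact one_sub_pow_ne_zero' hQ (n + 1) (by simp)
  · have := (multipliable_geom hQ Q).hasProd.tendsto_prod_nat
    simpa only [← pow_succ'] using! this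

lemma ipoch_tendsto {Q E : ℂ} (hE : E ≠ 0) (h : Tendsto (poch Q) atTop (𝓝 E)) :
    Tendsto (ipoch Q) atTop (𝓝 E⁻¹) := by
  have h1 : Tendsto (fun n : ℤ => (poch Q n.toNat)⁻¹) atTop (𝓝 E⁻¹) := by
    refine (h.inv₀ hE).comp ?_
    refine tendsto_atTop.2 fun b => ?_
    filter_upwards [eventually_ge_atTop (b : ℤ)] with n hn
    omega
  refine h1.congr' ?_
  filter_upwards [eventually_ge_atTop (0 : ℤ)] with n hn
  simp [ipoch, not_lt.mpr hn]

lemma ipoch_bdd {Q E : ℂ} (hE : E ≠ 0) (h : Tendsto (poch Q) atTop (𝓝 E)) :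
    ∃ C, ∀ n, ‖ipoch Q n‖ ≤ C := by
  obtain ⟨C, hC⟩ := (Metric.isBounded_range_of_tendsto _ (h.inv₀ hE)).exists_norm_le
  have h0 : 0 ≤ C := (norm_nonneg _).trans (hC _ ⟨0, rfl⟩)
  refine ⟨C, fun n => ?_⟩
  unfold ipoch
  split_ifs
  · simpa using h0
  · exact hC _ ⟨_, rfl⟩

lemma triple_product {Q : ℂ} (hQ : ‖Q‖ < 1) (h0 : Q ≠ 0) : ∃ E : ℂ, E ≠ 0 ∧
    ∀ w : ℂ, w ≠ 0 → ∀ t : ℤ → ℂ, t 0 = 1 → (∀ n, t (n + 1) = - w * Q ^ (n + 1) * t n) →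
    Summable t → HasProd (fun k : ℕ => (1 - w⁻¹ * Q ^ k) * (1 - w * Q ^ (k + 1)))
      (E * ∑' n, t n) := by
  obtain ⟨E, hE, hl⟩ := poch_tendsto hQ
  obtain ⟨C, hC⟩ := ipoch_bdd hE hl
  obtain ⟨C', hC'⟩ := (Metric.isBounded_range_of_tendsto _ hl).exists_norm_le
  refine ⟨E⁻¹, inv_ne_zero hE, fun w hw t t0 ht hs => ?_⟩
  have hm : Multipliable fun k : ℕ => (1 - w⁻¹ * Q ^ k) * (1 - w * Q ^ (k + 1)) := by
    have := (multipliable_geom hQ w⁻¹).mul (multipliable_geom hQ (w * Q))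
    simpa only [mul_assoc w Q, ← pow_succ'] using this
  have h1 := hm.hasProd.tendsto_prod_nat
  have h2 : Tendsto (fun N : ℕ => ∑' n : ℤ, gbin Q N n * t n) atTop (𝓝 (∑' n, E⁻¹ * t n)) := by
    refine tendsto_tsum_of_dominated_convergence (bound := fun n => C' * C * C * ‖t n‖)
      (hs.norm.mul_left _) (fun n => ?_) (Eventually.of_forall fun N n => ?_)
    · refine Tendsto.mul_const _ ?_
      have hi := ipoch_tendsto hE hl
      have hN : Tendsto (fun N : ℕ => (N : ℤ)) atTop atTop := tendsto_natCast_atTop_atTop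
      have e1 := hi.comp (tendsto_atTop_add_const_right _ n hN)
      have e2 := hi.comp (tendsto_atTop_add_const_right _ (-n) hN)
      have e3 := hl.comp (tendsto_id.const_mul_atTop' (show 0 < 2 by norm_num))
      have := (e3.mul e1).mul e2
      rwa [mul_inv_cancel₀ hE, one_mul] at this
    · rw [norm_mul, gbin, norm_mul, norm_mul]
      have := hC (N + n)
      have := hC (N - n)
      have := hC' _ ⟨2 * N, rfl⟩
      have : 0 ≤ C := (norm_nonneg _).trans (hC 0)
      have : 0 ≤ C' := (norm_nonneg _).trans (hC' _ ⟨0, rfl⟩)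
      gcongr
  simp only [(finite_triple hQ h0 hw t t0 ht _).tsum_eq] at h2
  rw [tsum_mul_left] at h2
  rw [← tendsto_nhds_unique h1 h2]
  exact hm.hasProd

/-- Odd theta function, up to normalization. -/
noncomputable def oddTheta (z τ : ℂ) : ℂ :=
  cexp (Real.pi * I * z) * jacobiTheta₂ (z + 1 / 2 + τ / 2) τ

lemma cexp_eq_of_sub {a b : ℂ} (n : ℤ) (h : a = b + n * (2 * Real.pi * I)) : cexp a = cexp b :=
  Complex.exp_eq_exp_iff_exists_int.mpr ⟨n, h⟩

lemma cexp_eq_neg_of_sub {a b : ℂ} (n : ℤ) (h : a = b + Real.pi * I + n * (2 * Real.pi * I)) :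
    cexp a = - cexp b := by
  rw [cexp_eq_of_sub n h, Complex.exp_add, Complex.exp_pi_mul_I]; ring

lemma oddTheta_add_one (z τ : ℂ) : oddTheta (z + 1) τ = - oddTheta z τ := by
  unfold oddTheta
  rw [show z + 1 + 1 / 2 + τ / 2 = (z + 1 / 2 + τ / 2) + 1 by ring, jacobiTheta₂_add_left,
    cexp_eq_neg_of_sub (b := Real.pi * I * z) 0 (by push_cast; ring)]
  ring

lemma oddTheta_sub_nat (z τ : ℂ) (k : ℕ) : oddTheta (z - k) τ = (-1) ^ k * oddTheta z τ := by
  induction k with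
  | zero => simp
  | succ k ih =>
    have := oddTheta_add_one (z - (k + 1 : ℕ)) τ
    rw [show z - (k + 1 : ℕ) + 1 = z - k by push_cast; ring, ih] at this
    rw [pow_succ, mul_assoc, neg_one_mul, mul_neg]; linear_combination this

lemma oddTheta_neg (z τ : ℂ) : oddTheta (-z) τ = - oddTheta z τ := by
  unfold oddTheta
  have h1 := jacobiTheta₂_add_left' (-(z + 1 / 2 + τ / 2)) τ
  have h2 := jacobiTheta₂_add_left (-(z + 1 / 2 + τ / 2) + τ) τ
  rw [show -z + 1 / 2 + τ / 2 = -(z + 1 / 2 + τ / 2) + τ + 1 by ring, h2, h1,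
    jacobiTheta₂_neg_left, ← mul_assoc, ← Complex.exp_add,
    cexp_eq_neg_of_sub (b := Real.pi * I * z) 0 (by push_cast; ring)]
  ring

lemma oddTheta_add_tau (z τ : ℂ) :
    oddTheta (z + τ) τ = - cexp (- Real.pi * I * (τ + 2 * z)) * oddTheta z τ := by
  unfold oddTheta
  rw [show z + τ + 1 / 2 + τ / 2 = (z + 1 / 2 + τ / 2) + τ by ring, jacobiTheta₂_add_left',
    ← mul_assoc, ← Complex.exp_add, neg_mul (cexp _), ← mul_assoc, ← Complex.exp_add, ← neg_mul,
    cexp_eq_neg_of_sub (b := -Real.pi * I * (τ + 2 * z) + Real.pi * I * z) (-1)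
      (by push_cast; ring)]

lemma oddTheta_tau_add_one (z τ : ℂ) : oddTheta z (τ + 1) = oddTheta z τ := by
  unfold oddTheta jacobiTheta₂
  congr 1
  refine tsum_congr fun n => ?_
  unfold jacobiTheta₂_term
  obtain ⟨m, hm⟩ := Int.even_mul_succ_self n
  have hm' : (n : ℂ) * (n + 1) = m + m := by exact_mod_cast hm
  exact cexp_eq_of_sub m (by linear_combination (Real.pi * I) * hm')

lemma oddTheta_S (τ : ℂ) (hτ : 0 < τ.im) : ∃ K : ℂ, K ≠ 0 ∧ ∀ z,
    oddTheta (z / τ) (-1 / τ) = K * cexp (Real.pi * I * z ^ 2 / τ) * oddTheta z τ := by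
  have h0 : τ ≠ 0 := by rintro rfl; simp at hτ
  refine ⟨(-I * τ) ^ (1 / 2 : ℂ) * cexp (Real.pi * I * ((1 + τ) ^ 2 / (4 * τ) - 1)), ?_, fun z => ?_⟩
  · refine mul_ne_zero ?_ (Complex.exp_ne_zero _)
    rw [Complex.cpow_ne_zero_iff]; left; simp [h0]
  · have hS : (-I * τ) ^ (1 / 2 : ℂ) ≠ 0 := by
      rw [Complex.cpow_ne_zero_iff]; left; simp [h0]
    unfold oddTheta
    rw [jacobiTheta₂_functional_equation (z + 1 / 2 + τ / 2) τ]
    have h1 := jacobiTheta₂_add_left' ((z + 1 / 2 + τ / 2) / τ) (-1 / τ)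
    rw [show z / τ + 1 / 2 + -1 / τ / 2 = (z + 1 / 2 + τ / 2) / τ + -1 / τ by field_simp; ring, h1]
    generalize jacobiTheta₂ ((z + 1 / 2 + τ / 2) / τ) (-1 / τ) = J
    generalize (-I * τ) ^ (1 / 2 : ℂ) = S at *
    have : ∀ a b c d e : ℂ, S * cexp a * cexp b * (cexp c * (1 / S * cexp d * J)) =
        cexp (a + b + c + d) * J := by
      intro a b c d e
      simp only [Complex.exp_add]; field_simp
    rw [this _ _ _ _ 0, ← mul_assoc, ← Complex.exp_add]
    congr 1
    refine cexp_eq_of_sub 0 ?_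
    field_simp
    push_cast
    ring

lemma pairEquiv_bij : Function.Bijective (Sum.elim (fun p : ℤ × ℤ => (p.1 + p.2, p.1 - p.2))
    (fun p : ℤ × ℤ => (p.1 + p.2, p.1 - p.2 - 1))) := by
  constructor
  · rintro (⟨a, b⟩ | ⟨a, b⟩) (⟨c, d⟩ | ⟨c, d⟩) h <;> simp at h ⊢ <;> omega
  · rintro ⟨m, n⟩
    rcases Int.even_or_odd (m + n) with h | h
    · exact ⟨Sum.inl ((m + n) / 2, (m - n) / 2), by
        obtain ⟨k, hk⟩ := h; simp; omega⟩
    · exact ⟨Sum.inr ((m + n + 1) / 2, (m - n - 1) / 2), by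
        obtain ⟨k, hk⟩ := h; simp; omega⟩

lemma hasSum_mul_aux {f g : ℤ → ℂ} {a b : ℂ} (h1 : HasSum f a) (h2 : HasSum g b) :
    HasSum (fun p : ℤ × ℤ => f p.1 * g p.2) (a * b) := by
  have h3 := summable_mul_of_summable_norm h1.summable.norm h2.summable.norm
  exact HasSum.mul h1 h2 h3

lemma th0 (u σ : ℂ) (hσ : 0 < σ.im) : HasSum (fun p : ℤ =>
      jacobiTheta₂_term p u σ) (jacobiTheta₂ u σ) :=
  hasSum_jacobiTheta₂_term u hσ

lemma theta_mul_hasSum (u v σ : ℂ) (hσ : 0 < σ.im) : HasSum (fun p : ℤ × ℤ =>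
      jacobiTheta₂_term p.1 u σ * jacobiTheta₂_term p.2 v σ)
      (jacobiTheta₂ u σ * jacobiTheta₂ v σ) :=
 hasSum_mul_aux (f := fun p : ℤ =>
      jacobiTheta₂_term p u σ) (g := fun p : ℤ =>
      jacobiTheta₂_term p v σ) (th0 u σ hσ) (th0 v σ hσ)

/-- Summand of the product of two odd theta values. -/
noncomputable def pairTerm (x y τ : ℂ) (p : ℤ × ℤ) : ℂ :=
  cexp (Real.pi * I * (x + y)) * cexp (Real.pi * I * (x - y)) *
    (jacobiTheta₂_term p.1 (x + y + 1 / 2 + τ / 2) τ *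
      jacobiTheta₂_term p.2 (x - y + 1 / 2 + τ / 2) τ)

lemma pairTerm_inl (x y τ : ℂ) (p : ℤ × ℤ) : pairTerm x y τ (p.1 + p.2, p.1 - p.2) =
    cexp (2 * Real.pi * I * x) *
      (jacobiTheta₂_term p.1 (2 * x + τ) (2 * τ) * jacobiTheta₂_term p.2 (2 * y) (2 * τ)) := by
  obtain ⟨a, b⟩ := p
  simp only [pairTerm, jacobiTheta₂_term, ← Complex.exp_add]
  exact cexp_eq_of_sub a (by push_cast; ring)

lemma pairTerm_inr (x y τ : ℂ) (p : ℤ × ℤ) : pairTerm x y τ (p.1 + p.2, p.1 - p.2 - 1) =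
    - cexp (2 * Real.pi * I * y) *
      (jacobiTheta₂_term p.1 (2 * x) (2 * τ) * jacobiTheta₂_term p.2 (2 * y + τ) (2 * τ)) := by
  obtain ⟨a, b⟩ := p
  simp only [pairTerm, jacobiTheta₂_term, ← Complex.exp_add, neg_mul]
  exact cexp_eq_neg_of_sub (a - 1) (by push_cast; ring)

lemma hasSum_pair {F : ℤ × ℤ → ℂ} {a b c : ℂ} (h : HasSum F c)
    (h1 : HasSum (fun p : ℤ × ℤ => F (p.1 + p.2, p.1 - p.2)) a)
    (h2 : HasSum (fun p : ℤ × ℤ => F (p.1 + p.2, p.1 - p.2 - 1)) b) : c = a + b := by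
  have e3 := ((Equiv.ofBijective _ pairEquiv_bij).hasSum_iff (f := F)).2 h
  exact e3.unique (HasSum.sum h1 h2)

lemma oddTheta_mul (τ : ℂ) (hτ : 0 < τ.im) : ∃ G H : ℂ → ℂ, ∀ x y,
    oddTheta (x + y) τ * oddTheta (x - y) τ = H x * G y - G x * H y := by
  have h2 : 0 < (2 * τ).im := by simpa using hτ
  refine ⟨fun x => jacobiTheta₂ (2 * x) (2 * τ),
    fun x => cexp (2 * Real.pi * I * x) * jacobiTheta₂ (2 * x + τ) (2 * τ), fun x y => ?_⟩
  have e : HasSum (pairTerm x y τ) _ :=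
    (theta_mul_hasSum (x + y + 1 / 2 + τ / 2) (x - y + 1 / 2 + τ / 2) τ hτ).mul_left
      (cexp (Real.pi * I * (x + y)) * cexp (Real.pi * I * (x - y)))
  have e1 := (theta_mul_hasSum (2 * x + τ) (2 * y) (2 * τ) h2).mul_left (cexp (2 * Real.pi * I * x))
  have e2 := (theta_mul_hasSum (2 * x) (2 * y + τ) (2 * τ) h2).mul_left
    (- cexp (2 * Real.pi * I * y))
  simp only [← pairTerm_inl] at e1
  simp only [← pairTerm_inr] at e2
  have key := hasSum_pair e e1 e2
  unfold oddTheta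
  linear_combination key

lemma oddTheta_klein (τ σ : ℂ) (hτ : 0 < τ.im) :
    oddTheta (5 * σ) τ * oddTheta σ τ ^ 3 = oddTheta (4 * σ) τ * oddTheta (2 * σ) τ ^ 3
      - oddTheta σ τ * oddTheta (3 * σ) τ ^ 3 := by
  obtain ⟨G, H, h⟩ := oddTheta_mul τ hτ
  have h32 := h (3 * σ) (2 * σ)
  have h31 := h (3 * σ) (σ)
  have h21 := h (2 * σ) (σ)
  have h10 := h (σ) 0
  have h20 := h (2 * σ) 0
  have h30 := h (3 * σ) 0
  rw [show 3 * σ + 2 * σ = 5 * σ by ring, show 3 * σ - 2 * σ = σ by ring] at h32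
  rw [show 3 * σ + σ = 4 * σ by ring, show 3 * σ - σ = 2 * σ by ring] at h31
  rw [show 2 * σ + σ = 3 * σ by ring, show 2 * σ - σ = σ by ring] at h21
  simp only [add_zero, sub_zero] at h10 h20 h30
  calc _ = (oddTheta (5 * σ) τ * oddTheta σ τ) * (oddTheta σ τ * oddTheta σ τ) := by ring
    _ = (oddTheta (4 * σ) τ * oddTheta (2 * σ) τ) * (oddTheta (2 * σ) τ * oddTheta (2 * σ) τ) -
      (oddTheta (3 * σ) τ * oddTheta σ τ) * (oddTheta (3 * σ) τ * oddTheta (3 * σ) τ) := by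
        rw [h32, h31, h21, h10, h20, h30]; ring
    _ = _ := by ring

lemma norm_q_lt_one {τ : ℂ} (hτ : 0 < τ.im) : ‖cexp (2 * Real.pi * I * τ)‖ < 1 := by
  rw [Complex.norm_exp, Real.exp_lt_one_iff]
  have : (2 * Real.pi * I * τ).re = - (2 * Real.pi * τ.im) := by simp
  rw [this]
  have := Real.pi_pos
  have : 0 < 2 * Real.pi * τ.im := by positivity
  linarith

lemma oddTheta_product (τ : ℂ) (hτ : 0 < τ.im) : ∃ c : ℂ, c ≠ 0 ∧ ∀ k l : ℕ, k ≠ 0 → l ≠ 0 →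
    k + l = 7 → ∃ P : ℂ, P ≠ 0 ∧
      HasProd (fun j : ℕ => (1 - cexp (2 * Real.pi * I * τ) ^ (7 * j + k)) *
        (1 - cexp (2 * Real.pi * I * τ) ^ (7 * j + l))) P ∧
      oddTheta (k * τ) (7 * τ) = c * cexp (- Real.pi * I * τ) ^ k * P := by
  have hq := norm_q_lt_one hτ
  have hτ7 : 0 < (7 * τ).im := by simpa using hτ
  have hq0 : cexp (2 * Real.pi * I * τ) ≠ 0 := Complex.exp_ne_zero _
  have hw : ∀ k : ℕ, cexp (2 * Real.pi * I * τ) ^ k = cexp (2 * Real.pi * I * (k * τ)) := by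
    intro k; rw [← Complex.exp_nat_mul]; congr 1; ring
  set q := cexp (2 * Real.pi * I * τ) with hqdef
  have hQ : ‖q ^ 7‖ < 1 := by rw [norm_pow]; exact pow_lt_one₀ (norm_nonneg _) hq (by norm_num)
  obtain ⟨E, hE, hT⟩ := triple_product hQ (pow_ne_zero 7 hq0)
  refine ⟨- E⁻¹, neg_ne_zero.mpr (inv_ne_zero hE), fun k l hk hl hkl => ?_⟩
  have hprod := hT (q ^ k)⁻¹ (inv_ne_zero (pow_ne_zero k hq0))
    (fun n => jacobiTheta₂_term n (-(k * τ) + 1 / 2 + (7 * τ) / 2) (7 * τ))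
    (by simp [jacobiTheta₂_term]) (fun n => by
      rw [hw, hw, ← Complex.exp_neg, ← Complex.exp_int_mul]
      simp only [jacobiTheta₂_term, neg_mul, ← Complex.exp_add]
      exact cexp_eq_neg_of_sub 0 (by push_cast; ring))
    ((summable_jacobiTheta₂_term_iff _ _).2 hτ7)
  have hfun : (fun j : ℕ => (1 - ((q ^ k)⁻¹)⁻¹ * (q ^ 7) ^ j) * (1 - (q ^ k)⁻¹ * (q ^ 7) ^ (j + 1)))
      = fun j : ℕ => (1 - q ^ (7 * j + k)) * (1 - q ^ (7 * j + l)) := by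
    ext j
    have hk0 : q ^ k ≠ 0 := pow_ne_zero k hq0
    have e1 : ((q ^ k)⁻¹)⁻¹ * (q ^ 7) ^ j = q ^ (7 * j + k) := by
      rw [inv_inv, ← pow_mul, ← pow_add, add_comm]
    have e2 : (q ^ k)⁻¹ * (q ^ 7) ^ (j + 1) = q ^ (7 * j + l) := by
      rw [inv_mul_eq_iff_eq_mul₀ hk0, ← pow_mul, ← pow_add]; congr 1; omega
    rw [e1, e2]
  rw [hfun] at hprod
  have hne : ∀ m : ℕ, m ≠ 0 → Multipliable (fun j : ℕ => 1 - q ^ (7 * j + m)) ∧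
      ∏' j : ℕ, (1 - q ^ (7 * j + m)) ≠ 0 := by
    intro m hm
    have e : ∀ j : ℕ, q ^ (7 * j + m) = q ^ m * (q ^ 7) ^ j := by
      intro j; rw [← pow_mul, ← pow_add, add_comm]
    have h1 := multipliable_geom hQ (q ^ m)
    have h2 := tprod_geom_ne_zero hQ (q ^ m) (fun n => by
      rw [← e]; exact one_sub_pow_ne_zero' hq _ (by omega))
    simp only [← e] at h1 h2
    exact ⟨h1, h2⟩
  refine ⟨_, ?_, hprod, ?_⟩
  · have := ((hne k hk).1.hasProd.mul (hne l hl).1.hasProd).unique hprod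
    rw [← this]
    exact mul_ne_zero (hne k hk).2 (hne l hl).2
  · have := oddTheta_neg (-(k * τ)) (7 * τ)
    rw [neg_neg] at this
    rw [this, oddTheta, ← Complex.exp_nat_mul, jacobiTheta₂]
    rw [show (k : ℂ) * (- Real.pi * I * τ) = Real.pi * I * (-(k * τ)) by ring]
    field_simp

lemma hTau_formula (τ : ℂ) (hτ : 0 < τ.im) :
    (∀ k : ℕ, 1 ≤ k → k ≤ 5 → oddTheta (k * τ) (7 * τ) ≠ 0) ∧
    hTau τ = oddTheta (4 * τ) (7 * τ) * oddTheta (2 * τ) (7 * τ) ^ 3 /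
      (oddTheta (5 * τ) (7 * τ) * oddTheta τ (7 * τ) ^ 3) := by
  obtain ⟨c, hc, h⟩ := oddTheta_product τ hτ
  have hr0 : cexp (- Real.pi * I * τ) ≠ 0 := Complex.exp_ne_zero _
  constructor
  · intro k h1 h5
    obtain ⟨P, hP, -, hk⟩ := h k (7 - k) (by omega) (by omega) (by omega)
    rw [hk]
    exact mul_ne_zero (mul_ne_zero hc (pow_ne_zero _ hr0)) hP
  · obtain ⟨P1, hP1, hp1, h1⟩ := h 1 6 (by norm_num) (by norm_num) (by norm_num)
    obtain ⟨P2, hP2, hp2, h2⟩ := h 2 5 (by norm_num) (by norm_num) (by norm_num)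
    obtain ⟨P5, hP5, hp5, h5⟩ := h 5 2 (by norm_num) (by norm_num) (by norm_num)
    obtain ⟨P4, hP4, hp4, h4⟩ := h 4 3 (by norm_num) (by norm_num) (by norm_num)
    have e52 : P5 = P2 := by
      refine hp5.unique ?_
      simpa only [mul_comm] using! hp2
    subst e52
    have hall := (hp4.mul (hp2.pow 2)).div₀ (hp1.pow 3) (pow_ne_zero 3 hP1)
    have hval : hTau τ = (cexp (2 * Real.pi * I * τ))⁻¹ * (P4 * P5 ^ 2 / P1 ^ 3) := by
      unfold hTau
      simp only
      rw [← hall.tprod_eq]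
      congr 1
      refine tprod_congr fun n => ?_
      congr 1 <;> ring
    have hq : (cexp (2 * Real.pi * I * τ))⁻¹ = cexp (- Real.pi * I * τ) ^ 2 := by
      rw [← Complex.exp_neg, ← Complex.exp_nat_mul]; congr 1; push_cast; ring
    push_cast at h1 h2 h5 h4
    rw [one_mul] at h1
    rw [hval, hq, h1, h2, h5, h4]
    generalize cexp (- Real.pi * I * τ) = r at *
    field_simp

lemma hTau_first (τ : ℂ) (hτ : 0 < τ.im) (hτ' : 0 < ((2 * τ - 1) / (7 * τ - 3)).im) :
    hTau τ ≠ 0 ∧ hTau τ ≠ 1 ∧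
      hTau ((2 * τ - 1) / (7 * τ - 3)) = (hTau τ - 1) / hTau τ := by
  have hτ7 : 0 < (7 * τ).im := by simpa using hτ
  have hd : 0 < (7 * τ - 3).im := by simpa using hτ
  have hd0 : 7 * τ - 3 ≠ 0 := by intro h; rw [h] at hd; simp at hd
  obtain ⟨hne, hf⟩ := hTau_formula τ hτ
  obtain ⟨-, hf'⟩ := hTau_formula _ hτ'
  have n1 := hne 1 (by norm_num) (by norm_num)
  have n2 := hne 2 (by norm_num) (by norm_num)
  have n3 := hne 3 (by norm_num) (by norm_num)
  have n4 := hne 4 (by norm_num) (by norm_num)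
  have n5 := hne 5 (by norm_num) (by norm_num)
  push_cast at n1 n2 n3 n4 n5
  rw [one_mul] at n1
  have kl := oddTheta_klein (7 * τ) τ hτ7
  have h1 : hTau τ - 1 = oddTheta τ (7 * τ) * oddTheta (3 * τ) (7 * τ) ^ 3 /
      (oddTheta (5 * τ) (7 * τ) * oddTheta τ (7 * τ) ^ 3) := by
    have hden : oddTheta (5 * τ) (7 * τ) * oddTheta τ (7 * τ) ^ 3 ≠ 0 := by positivity
    rw [hf, div_sub_one hden]
    congr 1
    linear_combination -kl
  have hne0 : hTau τ ≠ 0 := by rw [hf]; positivity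
  have hne1 : hTau τ ≠ 1 := by
    rw [← sub_ne_zero, h1]; positivity
  refine ⟨hne0, hne1, ?_⟩
  rw [h1, hf, hf']
  obtain ⟨K, hK, hS⟩ := oddTheta_S (7 * τ - 3) hd
  have hper : ∀ z, oddTheta z (7 * τ - 3) = oddTheta z (7 * τ) := by
    intro z
    rw [← oddTheta_tau_add_one z (7 * τ - 3), ← oddTheta_tau_add_one z (7 * τ - 3 + 1),
      ← oddTheta_tau_add_one z (7 * τ - 3 + 1 + 1)]
    congr 1; ring
  have tr : ∀ k : ℕ, oddTheta (k * ((2 * τ - 1) / (7 * τ - 3))) (7 * ((2 * τ - 1) / (7 * τ - 3))) =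
      K * cexp (Real.pi * I * (2 * τ - 1) ^ 2 / (7 * τ - 3)) ^ (k ^ 2) * ((-1) ^ k *
        oddTheta ((2 * k) * τ) (7 * τ)) := by
    intro k
    have e : 7 * ((2 * τ - 1) / (7 * τ - 3)) = -1 / (7 * τ - 3) + 1 + 1 := by field_simp; ring
    rw [e, oddTheta_tau_add_one, oddTheta_tau_add_one, ← mul_div_assoc, hS, hper,
      ← Complex.exp_nat_mul]
    rw [show oddTheta ((k : ℂ) * (2 * τ - 1)) (7 * τ) = (-1) ^ k * oddTheta (2 * k * τ) (7 * τ) by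
      rw [← oddTheta_sub_nat]; congr 1; ring]
    congr 3
    push_cast; ring
  have t1 := tr 1
  have t2 := tr 2
  have t4 := tr 4
  have t5 := tr 5
  push_cast at t1 t2 t4 t5
  norm_num at t1 t2 t4 t5
  rw [t1, t2, t4, t5]
  have q8 := oddTheta_add_tau τ (7 * τ)
  have q10 := oddTheta_add_tau (3 * τ) (7 * τ)
  have q4 := oddTheta_add_tau (-(3 * τ)) (7 * τ)
  rw [oddTheta_neg] at q4
  rw [show τ + 7 * τ = 8 * τ by ring] at q8
  rw [show 3 * τ + 7 * τ = 10 * τ by ring] at q10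
  rw [show -(3 * τ) + 7 * τ = 4 * τ by ring] at q4
  rw [show -Real.pi * I * (7 * τ + 2 * τ) = (9 : ℕ) * (-Real.pi * I * τ) by push_cast; ring,
    Complex.exp_nat_mul] at q8
  rw [show -Real.pi * I * (7 * τ + 2 * (3 * τ)) = (13 : ℕ) * (-Real.pi * I * τ) by push_cast; ring,
    Complex.exp_nat_mul] at q10
  rw [show -Real.pi * I * (7 * τ + 2 * -(3 * τ)) = -Real.pi * I * τ by ring] at q4
  have hr0 : cexp (- Real.pi * I * τ) ≠ 0 := Complex.exp_ne_zero _
  have hx0 : cexp (Real.pi * I * (2 * τ - 1) ^ 2 / (7 * τ - 3)) ≠ 0 := Complex.exp_ne_zero _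
  rw [q8, q10, q4]
  generalize cexp (- Real.pi * I * τ) = r at *
  generalize cexp (Real.pi * I * (2 * τ - 1) ^ 2 / (7 * τ - 3)) = X at *
  generalize oddTheta τ (7 * τ) = A1 at *
  generalize oddTheta (2 * τ) (7 * τ) = A2 at *
  generalize oddTheta (3 * τ) (7 * τ) = A3 at *
  generalize oddTheta (5 * τ) (7 * τ) = A5 at *
  field_simp

lemma im_mobius (a b c d : ℝ) (had : a * d - b * c = 1) (hc : c ≠ 0) (τ : ℂ) (hτ : 0 < τ.im) :
    0 < ((a * τ + b) / (c * τ + d)).im := by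
  have h0 : (c * τ + d : ℂ) ≠ 0 := by
    intro h
    have := congrArg Complex.im h
    simp [hc, hτ.ne'] at this
  have hn : 0 < normSq (c * τ + d) := normSq_pos.mpr h0
  have : ((a * τ + b) / (c * τ + d)).im = τ.im / normSq (c * τ + d) := by
    rw [Complex.div_im]
    simp only [add_im, mul_im, ofReal_re, ofReal_im, add_re, mul_re]
    field_simp
    linear_combination τ.im * had
  rw [this]; positivity

/-- Theorem 11: the transformation formulas
`h((2τ-1)/(7τ-3)) = (h(τ)-1)/h(τ)` and `h((3τ-1)/(7τ-2)) = 1/(1-h(τ))`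
for `τ` in the upper half-plane, where also `h(τ) ≠ 0, 1`. -/
theorem hTau_transformation (τ : ℂ) (hτ : 0 < τ.im) :
    hTau τ ≠ 0 ∧ hTau τ ≠ 1 ∧
      hTau ((2 * τ - 1) / (7 * τ - 3)) = (hTau τ - 1) / hTau τ ∧
      hTau ((3 * τ - 1) / (7 * τ - 2)) = 1 / (1 - hTau τ) := by
  have i1 : 0 < ((2 * τ - 1) / (7 * τ - 3)).im := by
    have := im_mobius 2 (-1) 7 (-3) (by norm_num) (by norm_num) τ hτ
    push_cast at this
    simpa only [← sub_eq_add_neg] using this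
  have i2 : 0 < ((3 * τ - 1) / (7 * τ - 2)).im := by
    have := im_mobius 3 (-1) 7 (-2) (by norm_num) (by norm_num) τ hτ
    push_cast at this
    simpa only [← sub_eq_add_neg] using this
  obtain ⟨h0, h1, h2⟩ := hTau_first τ hτ i1
  refine ⟨h0, h1, h2, ?_⟩
  have hd0 : 7 * τ - 2 ≠ 0 := by
    intro h
    have := congrArg Complex.im h
    simp [hτ.ne'] at this
  have e : (2 * ((3 * τ - 1) / (7 * τ - 2)) - 1) / (7 * ((3 * τ - 1) / (7 * τ - 2)) - 3) = τ := by
    have e1 : 2 * ((3 * τ - 1) / (7 * τ - 2)) - 1 = -τ / (7 * τ - 2) := by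
      rw [← mul_div_assoc, div_sub_one hd0]; congr 1; ring
    have e2 : 7 * ((3 * τ - 1) / (7 * τ - 2)) - 3 = -1 / (7 * τ - 2) := by
      rw [← mul_div_assoc, div_sub' hd0]; congr 1; ring
    rw [e1, e2, div_div_div_cancel_right₀ hd0]; simp
  obtain ⟨g0, -, g2⟩ := hTau_first _ i2 (by rw [e]; exact hτ)
  rw [e] at g2
  have g3 : 1 - hTau τ ≠ 0 := sub_ne_zero.mpr (Ne.symm h1)
  rw [eq_div_iff g3, g2]
  generalize hTau ((3 * τ - 1) / (7 * τ - 2)) = B at *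
  field_simp
  ring
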